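/- (Proposition 7: unique solvability of the discretized mean field game system.) Fix positive integers N_x, N_y, constants Ū > 0 and L_Ū > 0, and a nonnegative matrix μ₀ with Σ_{i=1}^{N_x} (μ₀)_{i,j} = 1 for every j. Let U be a map that assigns to each matrix m with m_{i,j} ≥ 0 and Σ_{i=1}^{N_x} m_{i,j} = 1 for every j a matrix U(m) satisfying 0 ≤ U(m)_{i,j} ≤ Ū for all (i,j), and such that for any two such matrices m^{(1)}, m^{(2)} and all (i,j), |U(m^{(1)})_{i,j} − U(m^{(2)})_{i,j}| ≤ L_Ū · max_{1 ≤ j' ≤ N_y} Σ_{i'=1}^{N_x} |m^{(1)}_{i',j'} − m^{(2)}_{i',j'}|. Then there exists δ₀ > 0 such that for every δ > δ₀ there exists exactly one pair of matrices (m, Φ) with m_{i,j} ≥ 0 for all (i,j), Σ_{i=1}^{N_x} m_{i,j} = 1 for every j, and 0 ≤ Φ_{i,j} ≤ Ū for all (i,j), satisfying for all (i,j): 0 = δ (μ₀)_{i,j} − (δ − (Φ_{i,j} − Σ_{k=1}^{N_x} Φ_{k,j} m_{k,j})) m_{i,j} and 0 = −Φ_{i,j} + U(m)_{i,j} + (1/(2δ))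 Σ_{k=1}^{N_x} ((Φ_{k,j} − Φ_{i,j})₊)² m_{k,j}. -/

import Mathlib

lemma aux_fix {X : Type*} [MetricSpace X] [CompleteSpace X] (s : Set X) (hs : IsClosed s)
    (hne : s.Nonempty) (f : X → X) (hf : Set.MapsTo f s s) (K : ℝ) (hK0 : 0 ≤ K) (hK : K < 1)
    (hL : ∀ x ∈ s, ∀ y ∈ s, dist (f x) (f y) ≤ K * dist x y) :
    ∃! x, x ∈ s ∧ f x = x := by
  obtain ⟨x0, hx0⟩ := hne
  have hc : ContractingWith ⟨K, hK0⟩ (hf.restrict f s s) := by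
    refine ⟨by exact_mod_cast hK, LipschitzWith.of_dist_le_mul ?_⟩
    rintro ⟨x, hx⟩ ⟨y, hy⟩
    exact hL x hx y hy
  obtain ⟨y, hy, hfy, -⟩ := hc.exists_fixedPoint' hs.isComplete hf hx0 (edist_ne_top _ _)
  refine ⟨y, ⟨hy, hfy⟩, ?_⟩
  rintro z ⟨hz, hfz⟩
  have h := hL z hz y hy
  rw [hfz, hfy] at h
  have h0 : dist z y ≤ 0 := by
    have := dist_nonneg (x := z) (y := y)
    nlinarith
  exact dist_le_zero.mp h0

lemma aux_mul {a a' b b' A B D E : ℝ} (ha : |a| ≤ A) (hb : |b'| ≤ B)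
    (h1 : |a - a'| ≤ D) (h2 : |b - b'| ≤ E) : |a * b - a' * b'| ≤ A * E + B * D := by
  have : a * b - a' * b' = a * (b - b') + b' * (a - a') := by ring
  rw [this]
  refine (abs_add_le _ _).trans ?_
  rw [abs_mul, abs_mul]
  have := abs_nonneg a
  have := abs_nonneg b'
  have := abs_nonneg (a - a')
  have := abs_nonneg (b - b')
  gcongr
  · linarith
  · linarith

lemma aux_sum {n : ℕ} {f g : Fin n → ℝ} {E : ℝ} (h : ∀ k, |f k - g k| ≤ E) :
    |∑ k, f k - ∑ k, g k| ≤ n * E := by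
  rw [← Finset.sum_sub_distrib]
  refine (Finset.abs_sum_le_sum_abs _ _).trans ?_
  refine (Finset.sum_le_sum fun k _ => h k).trans ?_
  simp

lemma aux_avg {n : ℕ} {m P : Fin n → ℝ} {u : ℝ} (hm : ∀ i, 0 ≤ m i)
    (hs : ∑ i, m i = 1) (hP : ∀ i, 0 ≤ P i ∧ P i ≤ u) :
    0 ≤ ∑ k, P k * m k ∧ ∑ k, P k * m k ≤ u := by
  constructor
  · exact Finset.sum_nonneg fun k _ => mul_nonneg (hP k).1 (hm k)
  · calc ∑ k, P k * m k ≤ ∑ k, u * m k :=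
        Finset.sum_le_sum fun k _ => mul_le_mul_of_nonneg_right (hP k).2 (hm k)
      _ = u := by rw [← Finset.mul_sum, hs, mul_one]

lemma aux_le_one {n : ℕ} {m : Fin n → ℝ} (hm : ∀ i, 0 ≤ m i)
    (hs : ∑ i, m i = 1) (i : Fin n) : m i ≤ 1 := by
  rw [← hs]
  exact Finset.single_le_sum (fun k _ => hm k) (Finset.mem_univ i)

lemma aux_G {n : ℕ} {m m' P P' : Fin n → ℝ} {u D : ℝ} (hu : 0 < u)
    (hm : ∀ i, 0 ≤ m i) (hs : ∑ i, m i = 1) (hP : ∀ i, 0 ≤ P i ∧ P i ≤ u)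
    (hm' : ∀ i, 0 ≤ m' i) (hs' : ∑ i, m' i = 1) (hP' : ∀ i, 0 ≤ P' i ∧ P' i ≤ u)
    (h1 : ∀ i, |m i - m' i| ≤ D) (h2 : ∀ i, |P i - P' i| ≤ D) (i : Fin n) :
    |(u + P i - ∑ k, P k * m k) * m i - (u + P' i - ∑ k, P' k * m' k) * m' i|
      ≤ (2 * u + 1 + n * (u + 1)) * D := by
  have a1 := aux_avg hm hs hP
  have hav : |∑ k, P k * m k - ∑ k, P' k * m' k| ≤ n * (u * D + 1 * D) := by
    refine aux_sum fun k => aux_mul ?_ ?_ (h2 k) (h1 k)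
    · rw [abs_le]; constructor <;> linarith [hP k]
    · rw [abs_of_nonneg (hm' k)]; exact aux_le_one hm' hs' k
  have := aux_mul (a := u + P i - ∑ k, P k * m k) (a' := u + P' i - ∑ k, P' k * m' k)
    (b := m i) (b' := m' i) (A := 2 * u) (B := 1) (D := D + n * (u * D + 1 * D)) (E := D)
    (by rw [abs_le]; constructor <;> linarith [hP i])
    (by rw [abs_of_nonneg (hm' i)]; exact aux_le_one hm' hs' i)
    (by
      have e1 := abs_le.mp (h2 i)
      have e2 := abs_le.mp hav
      rw [abs_le]; constructor <;> linarith) (h1 i)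
  linarith

lemma aux_pos {a b u D : ℝ} (hu : 0 < u) (ha : a ≤ u) (hb : b ≤ u) (h : |a - b| ≤ D) :
    |(max a 0) ^ 2 - (max b 0) ^ 2| ≤ 2 * u * D := by
  have e : |max a 0 - max b 0| ≤ D := (abs_max_sub_max_le_abs a b 0).trans h
  have a0 : |max a 0| ≤ u := by
    rw [abs_of_nonneg (le_max_right _ _)]; exact max_le ha hu.le
  have b0 : |max b 0| ≤ u := by
    rw [abs_of_nonneg (le_max_right _ _)]; exact max_le hb hu.le
  have := aux_mul a0 b0 e e
  rw [pow_two, pow_two]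
  linarith

lemma aux_H {n : ℕ} {m m' P P' : Fin n → ℝ} {u D : ℝ} (hu : 0 < u)
    (hP : ∀ i, 0 ≤ P i ∧ P i ≤ u)
    (hm' : ∀ i, 0 ≤ m' i) (hs' : ∑ i, m' i = 1) (hP' : ∀ i, 0 ≤ P' i ∧ P' i ≤ u)
    (h1 : ∀ i, |m i - m' i| ≤ D) (h2 : ∀ i, |P i - P' i| ≤ D) (i : Fin n) :
    |∑ k, (max (P k - P i) 0) ^ 2 * m k - ∑ k, (max (P' k - P' i) 0) ^ 2 * m' k|
      ≤ n * (u ^ 2 + 4 * u) * D := by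
  have := aux_sum (f := fun k => (max (P k - P i) 0) ^ 2 * m k)
    (g := fun k => (max (P' k - P' i) 0) ^ 2 * m' k) (E := u ^ 2 * D + 1 * (2 * u * (2 * D)))
    (fun k => aux_mul ?_ ?_ (aux_pos hu ?_ ?_ ?_) (h1 k))
  · linarith
  · rw [abs_of_nonneg (sq_nonneg _)]
    exact pow_le_pow_left₀ (le_max_right _ _) (max_le (by linarith [hP k, hP i]) hu.le) 2
  · rw [abs_of_nonneg (hm' k)]; exact aux_le_one hm' hs' k
  · linarith [hP k, hP i]
  · linarith [hP' k, hP' i]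
  · have e1 := abs_le.mp (h2 i)
    have e2 := abs_le.mp (h2 k)
    rw [abs_le]; constructor <;> linarith


/-- **Proposition 7: unique solvability of the discretized mean field game
system for all sufficiently large discount rates `δ`.** -/
theorem stmt16
    (Nx Ny : ℕ) [NeZero Nx] [NeZero Ny]
    (Ubar LU : ℝ) (hUbar : 0 < Ubar) (hLU : 0 < LU)
    (μ0 : Fin Nx → Fin Ny → ℝ)
    (hμ0 : ∀ i j, 0 ≤ μ0 i j) (hμ0s : ∀ j, ∑ i, μ0 i j = 1)
    (U : (Fin Nx → Fin Ny → ℝ) → Fin Nx → Fin Ny → ℝ)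
    (hUb : ∀ m : Fin Nx → Fin Ny → ℝ, (∀ i j, 0 ≤ m i j) → (∀ j, ∑ i, m i j = 1) →
      ∀ i j, 0 ≤ U m i j ∧ U m i j ≤ Ubar)
    (hUL : ∀ m₁ m₂ : Fin Nx → Fin Ny → ℝ,
      (∀ i j, 0 ≤ m₁ i j) → (∀ j, ∑ i, m₁ i j = 1) →
      (∀ i j, 0 ≤ m₂ i j) → (∀ j, ∑ i, m₂ i j = 1) →
      ∀ i j, |U m₁ i j - U m₂ i j| ≤ LU * ⨆ j' : Fin Ny, ∑ i', |m₁ i' j' - m₂ i' j'|) :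
    ∃ δ₀ > (0:ℝ), ∀ δ : ℝ, δ₀ < δ →
      ∃! p : (Fin Nx → Fin Ny → ℝ) × (Fin Nx → Fin Ny → ℝ),
        (∀ i j, 0 ≤ p.1 i j) ∧ (∀ j, ∑ i, p.1 i j = 1) ∧
        (∀ i j, 0 ≤ p.2 i j ∧ p.2 i j ≤ Ubar) ∧
        (∀ i j, 0 = δ * μ0 i j - (δ - (p.2 i j - ∑ k, p.2 k j * p.1 k j)) * p.1 i j) ∧
        (∀ i j, 0 = -p.2 i j + U p.1 i j +
          (1 / (2 * δ)) * ∑ k, (max (p.2 k j - p.2 i j) 0) ^ 2 * p.1 k j) := by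
  have hN : (0:ℝ) < Nx := by exact_mod_cast Nat.pos_of_ne_zero (NeZero.ne Nx)
  set A : ℝ := 2 * Ubar + 1 + Nx * (Ubar + 1) with hA
  set B : ℝ := Nx * (Ubar ^ 2 + 4 * Ubar) with hB
  have hApos : 0 < A := by positivity
  have hBpos : 0 < B := by positivity
  refine ⟨A + LU * Nx * A + B, by positivity, fun δ hδ => ?_⟩
  have hδ0 : 0 < δ := lt_trans (by positivity) hδ
  let G : (Fin Nx → Fin Ny → ℝ) × (Fin Nx → Fin Ny → ℝ) → Fin Nx → Fin Ny → ℝ := fun p i j =>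
    (δ * μ0 i j + (Ubar + p.2 i j - ∑ k, p.2 k j * p.1 k j) * p.1 i j) / (δ + Ubar)
  let H : (Fin Nx → Fin Ny → ℝ) × (Fin Nx → Fin Ny → ℝ) → Fin Nx → Fin Ny → ℝ := fun p i j =>
    min Ubar (U (G p) i j + (1 / (2 * δ)) * ∑ k, (max (p.2 k j - p.2 i j) 0) ^ 2 * p.1 k j)
  let s : Set ((Fin Nx → Fin Ny → ℝ) × (Fin Nx → Fin Ny → ℝ)) :=
    {p | (∀ i j, 0 ≤ p.1 i j) ∧ (∀ j, ∑ i, p.1 i j = 1) ∧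
        (∀ i j, 0 ≤ p.2 i j ∧ p.2 i j ≤ Ubar)}
  have hG0 : ∀ p ∈ s, ∀ i j, 0 ≤ G p i j := by
    rintro p ⟨hm, hs, hP⟩ i j
    have := aux_avg (fun i => hm i j) (hs j) (fun i => hP i j)
    refine div_nonneg (add_nonneg (mul_nonneg hδ0.le (hμ0 i j)) (mul_nonneg ?_ (hm i j)))
      (by linarith)
    linarith [hP i j]
  have hG1 : ∀ p ∈ s, ∀ j, ∑ i, G p i j = 1 := by
    rintro p ⟨hm, hs, hP⟩ j
    simp only [G]
    rw [← Finset.sum_div, div_eq_one_iff_eq (by linarith), Finset.sum_add_distrib,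
      ← Finset.mul_sum, hμ0s]
    simp only [sub_mul, add_mul, Finset.sum_sub_distrib, Finset.sum_add_distrib, ← Finset.mul_sum,
      hs j]
    ring
  have hsq : ∀ p ∈ s, ∀ i j,
      0 ≤ (1 / (2 * δ)) * ∑ k, (max (p.2 k j - p.2 i j) 0) ^ 2 * p.1 k j := by
    rintro p ⟨hm, hs, hP⟩ i j
    exact mul_nonneg (by positivity)
      (Finset.sum_nonneg fun k _ => mul_nonneg (sq_nonneg _) (hm k j))
  have hmaps : Set.MapsTo (fun p => (G p, H p)) s s := by
    intro p hp
    refine ⟨hG0 p hp, hG1 p hp, fun i j => ⟨le_min hUbar.le ?_, min_le_left _ _⟩⟩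
    exact add_nonneg (hUb _ (hG0 p hp) (hG1 p hp) i j).1 (hsq p hp i j)
  have hcl : IsClosed s := by
    simp only [s, Set.setOf_and, Set.setOf_forall]
    refine IsClosed.inter ?_ (IsClosed.inter ?_ ?_)
    · exact isClosed_iInter fun i => isClosed_iInter fun j =>
        isClosed_le continuous_const (by fun_prop)
    · exact isClosed_iInter fun j => isClosed_eq (by fun_prop) continuous_const
    · exact isClosed_iInter fun i => isClosed_iInter fun j => IsClosed.inter
        (isClosed_le continuous_const (by fun_prop)) (isClosed_le (by fun_prop) continuous_const)
  have hne : s.Nonempty := ⟨(μ0, 0), hμ0, hμ0s, fun i j => ⟨le_rfl, hUbar.le⟩⟩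
  have key := aux_fix s hcl hne (fun p => (G p, H p)) hmaps ((A + LU * Nx * A + B) / δ)
    (by positivity) (by rwa [div_lt_one hδ0]) (by
      intro p hp q hq
      obtain ⟨hm, hs, hP⟩ := id hp
      obtain ⟨hm', hs', hP'⟩ := id hq
      set D := dist p q with hD
      have hD0 : 0 ≤ D := dist_nonneg
      have h1 : ∀ i j, |p.1 i j - q.1 i j| ≤ D := fun i j =>
        ((dist_le_pi_dist (p.1 i) (q.1 i) j).trans (dist_le_pi_dist p.1 q.1 i)).trans
          (le_max_left _ _)
      have h2 : ∀ i j, |p.2 i j - q.2 i j| ≤ D := fun i j =>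
        ((dist_le_pi_dist (p.2 i) (q.2 i) j).trans (dist_le_pi_dist p.2 q.2 i)).trans
          (le_max_right _ _)
      have hGL : ∀ i j, |G p i j - G q i j| ≤ A / δ * D := by
        intro i j
        have := aux_G hUbar (fun i => hm i j) (hs j) (fun i => hP i j) (fun i => hm' i j) (hs' j)
          (fun i => hP' i j) (fun i => h1 i j) (fun i => h2 i j) i
        simp only [G]
        rw [← sub_div, abs_div, abs_of_pos (show 0 < δ + Ubar by linarith), add_sub_add_left_eq_sub,
          div_mul_eq_mul_div]
        exact div_le_div₀ (by positivity) this hδ0 (by linarith)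
      have hKK : 0 ≤ (A + LU * Nx * A + B) / δ * D := by positivity
      refine max_le ?_ ?_
      · refine (dist_pi_le_iff hKK).2 fun i => (dist_pi_le_iff hKK).2 fun j => (hGL i j).trans ?_
        gcongr
        have : 0 < LU * Nx * A := by positivity
        linarith
      · refine (dist_pi_le_iff hKK).2 fun i => (dist_pi_le_iff hKK).2 fun j => ?_
        have hU1 : |U (G p) i j - U (G q) i j| ≤ LU * (Nx * (A / δ * D)) := by
          refine (hUL _ _ (hG0 p hp) (hG1 p hp) (hG0 q hq) (hG1 q hq) i j).trans ?_
          refine mul_le_mul_of_nonneg_left (ciSup_le fun j' => ?_) hLU.le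
          refine (Finset.sum_le_sum fun k _ => hGL k j').trans ?_
          simp
        have hH1 := aux_H hUbar (fun i => hP i j) (fun i => hm' i j) (hs' j)
          (fun i => hP' i j) (fun i => h1 i j) (fun i => h2 i j) i
        have hH2 : |(1 / (2 * δ)) * ∑ k, (max (p.2 k j - p.2 i j) 0) ^ 2 * p.1 k j -
            (1 / (2 * δ)) * ∑ k, (max (q.2 k j - q.2 i j) 0) ^ 2 * q.1 k j| ≤ B / δ * D := by
          rw [← mul_sub, abs_mul, abs_of_pos (by positivity)]
          calc _ ≤ 1 / δ * (B * D) := by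
                refine mul_le_mul ?_ hH1 (abs_nonneg _) (by positivity)
                exact one_div_le_one_div_of_le hδ0 (by linarith)
            _ = _ := by ring
        rw [Real.dist_eq]
        simp only [H]
        rw [min_comm Ubar, min_comm Ubar]
        refine (abs_min_sub_min_le_max _ _ _ _).trans (max_le ?_ (by simpa using hKK))
        have e1 := abs_le.mp hU1
        have e2 := abs_le.mp hH2
        have e3 : LU * (Nx * (A / δ * D)) + B / δ * D ≤ (A + LU * Nx * A + B) / δ * D := by
          have : 0 ≤ A / δ * D := by positivity
          have e : (A + LU * Nx * A + B) / δ * D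
            = A / δ * D + (LU * (Nx * (A / δ * D)) + B / δ * D) := by ring
          linarith
        rw [abs_le]; constructor <;> linarith)
  refine (existsUnique_congr fun p => ?_).mp key
  have hGiff : G p = p.1 ↔
      ∀ i j, 0 = δ * μ0 i j - (δ - (p.2 i j - ∑ k, p.2 k j * p.1 k j)) * p.1 i j := by
    rw [funext_iff]
    refine forall_congr' fun i => ?_
    rw [funext_iff]
    refine forall_congr' fun j => ?_
    simp only [G]
    rw [div_eq_iff (by linarith)]
    constructor <;> intro h <;> linarith
  constructor
  · rintro ⟨hp, hfp⟩
    have hg : G p = p.1 := congrArg Prod.fst hfp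
    have hh : H p = p.2 := congrArg Prod.snd hfp
    refine ⟨hp.1, hp.2.1, hp.2.2, hGiff.1 hg, fun i j => ?_⟩
    have e := congrFun (congrFun hh i) j
    simp only [H, hg] at e
    rcases le_total (U p.1 i j + (1 / (2 * δ)) * ∑ k, (max (p.2 k j - p.2 i j) 0) ^ 2 * p.1 k j)
      Ubar with hle | hle
    · rw [min_eq_right hle] at e
      linarith
    · rw [min_eq_left hle] at e
      have hz : ∑ k, (max (p.2 k j - p.2 i j) 0) ^ 2 * p.1 k j = 0 := by
        refine Finset.sum_eq_zero fun k _ => ?_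
        rw [max_eq_right (by linarith [(hp.2.2 k j).2])]
        ring
      rw [hz] at hle ⊢
      linarith [(hUb p.1 hp.1 hp.2.1 i j).2]
  · rintro ⟨a, b, c, d, e⟩
    have hg := hGiff.2 d
    refine ⟨⟨a, b, c⟩, Prod.ext hg ?_⟩
    funext i j
    simp only [H, hg]
    rw [min_eq_right] <;> linarith [e i j, (c i j).2]
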